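/- arXiv:2211.11329 — 2 statements merged into one kernel-verified Lean document; each statement's English description precedes it below -/
import Mathlib

section
/- Let x ∈ ℝ², let U be an open neighborhood of x, let a ∈ ℂ, let u : U → ℂ be continuously differentiable, and let w(ξ) = a·log|ξ − x| + h(ξ) for ξ ∈ U \ {x}, where h : U → ℂ is continuously differentiable on U. Then lim_{ε → 0⁺} ∫₀^{2π} [ w(x + ε e_θ) (∇u(x + ε e_θ)·(−e_θ)) − (∇w(x + ε e_θ)·(−e_θ)) u(x + ε e_θ) ] ε dθ = 2π a u(x), where e_θ = (cos θ, sin θ). In other words, the integral over the circle of radius ε centered at x of (w ∂_ν u − (∂_ν w) u), taken with respect to arclength and with the unit normal ν pointing toward the center x, converges to 2π a u(x) as ε → 0⁺. -/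
noncomputable section
open MeasureTheory Real Filter Topology

/-- Points of the plane ℝ². -/
abbrev Pt : Type := EuclideanSpace ℝ (Fin 2)

/-- The point with coordinates (a, b). -/
def pt (a b : ℝ) : Pt := (WithLp.equiv 2 (Fin 2 → ℝ)).symm ![a, b]

/-- The point ρ·(cos θ, sin θ) on the circle of radius ρ. -/
def ptc (ρ θ : ℝ) : Pt := pt (ρ * Real.cos θ) (ρ * Real.sin θ)

/-- The Laplacian of a complex-valued function on ℝ². -/
def lap (u : Pt → ℂ) (x : Pt) : ℂ :=
  fderiv ℝ (fun y => fderiv ℝ u y (pt 1 0)) x (pt 1 0) +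
  fderiv ℝ (fun y => fderiv ℝ u y (pt 0 1)) x (pt 0 1)

/-- Radial (outward normal) derivative on a circle centered at the origin: ∇F(ξ)·(ξ/|ξ|). -/
def dnu (F : Pt → ℂ) (ξ : Pt) : ℂ := fderiv ℝ F ξ ((‖ξ‖⁻¹ : ℝ) • ξ)

/-- Integral over the circle ∂B_ρ: ∫₀^{2π} F(ρ cos θ, ρ sin θ) ρ dθ (complex valued). -/
def circInt (ρ : ℝ) (F : Pt → ℂ) : ℂ := ∫ θ in (0:ℝ)..(2 * π), F (ptc ρ θ) * (ρ : ℂ)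

/-- Integral over the circle ∂B_ρ: ∫₀^{2π} F(ρ cos θ, ρ sin θ) ρ dθ (real valued). -/
def circIntR (ρ : ℝ) (F : Pt → ℝ) : ℝ := ∫ θ in (0:ℝ)..(2 * π), F (ptc ρ θ) * ρ

/-- The background two-layer wavenumber κ₀ : equal to κ₁ on {x₂ > 0} and κ₂ on {x₂ ≤ 0}. -/
def kappa0 (κ1 κ2 : ℝ) (x : Pt) : ℝ := if 0 < x 1 then κ1 else κ2

theorem norm_ptc_one (θ : ℝ) : ‖ptc 1 θ‖ = 1 := by
  simp [ptc, pt, EuclideanSpace.norm_eq, Fin.sum_univ_two]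

theorem continuous_ptc_one : Continuous (ptc 1) := by
  unfold ptc pt
  simp only [WithLp.equiv_symm_apply]
  refine (PiLp.continuous_toLp 2 _).comp (continuous_pi fun i => ?_)
  fin_cases i <;> simp <;> fun_prop

/-- The radial derivative of `ξ ↦ a log ‖ξ - x‖` on the circle of radius `ε` is `a / ε`. -/
theorem hasFDerivAt_log_norm_sub {x : Pt} {ε : ℝ} (hε : 0 < ε) (a : ℂ) {e : Pt} (he : ‖e‖ = 1) :
    ∃ L : Pt →L[ℝ] ℂ, HasFDerivAt (fun ξ : Pt => a * (Real.log ‖ξ - x‖ : ℂ)) L (x + ε • e) ∧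
      L e = a * (ε⁻¹ : ℝ) := by
  have hsub : x + ε • e - x = ε • e := by abel
  have hn : ‖ε • e‖ = ε := by rw [norm_smul, he, Real.norm_of_nonneg hε.le, mul_one]
  have hsq : HasFDerivAt (fun ξ : Pt => ‖ξ - x‖ ^ 2) _ (x + ε • e) :=
    ((hasFDerivAt_id (𝕜 := ℝ) (x + ε • e)).sub_const x).norm_sq
  have hlog := ((hsq.log (by simp only [hsub, hn]; positivity)).const_mul (1 / 2 : ℝ))
  have heq : (fun ξ : Pt => 1 / 2 * Real.log (‖ξ - x‖ ^ 2)) = fun ξ => Real.log ‖ξ - x‖ := by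
    funext ξ
    rw [Real.log_pow]
    push_cast
    ring
  rw [heq] at hlog
  refine ⟨_, (Complex.ofRealCLM.hasFDerivAt.comp (x + ε • e) hlog).const_mul a, ?_⟩
  simp [hsub, hn, he]
  field_simp
  simp

/-- the small-circle limit of the Green pairing (w ∂_ν u − (∂_ν w) u) around a
logarithmic singularity w(ξ) = a·log|ξ − x| + h(ξ), with the unit normal pointing toward x:
the circle integral converges to 2π a u(x) as the radius ε → 0⁺. -/
theorem small_circle_limit
    (x : Pt) (U : Set Pt) (hU : IsOpen U) (hxU : x ∈ U) (a : ℂ)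
    (u h w : Pt → ℂ) (hu : ContDiffOn ℝ 1 u U) (hh : ContDiffOn ℝ 1 h U)
    (hw : ∀ ξ ∈ U \ {x}, w ξ = a * (Real.log ‖ξ - x‖ : ℂ) + h ξ) :
    Tendsto (fun ε : ℝ => ∫ θ in (0:ℝ)..(2 * π),
        (w (x + ε • ptc 1 θ) * fderiv ℝ u (x + ε • ptc 1 θ) (-(ptc 1 θ))
          - fderiv ℝ w (x + ε • ptc 1 θ) (-(ptc 1 θ)) * u (x + ε • ptc 1 θ)) * (ε : ℂ))
      (𝓝[>] (0:ℝ)) (𝓝 (((2 * π : ℝ) : ℂ) * a * u x)) := by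
  obtain ⟨r, hr, hrU⟩ := Metric.isOpen_iff.1 hU x hxU
  set δ : ℝ := r / 2 with hδ
  have hδ0 : 0 < δ := half_pos hr
  have hmem : ∀ ε θ : ℝ, 0 ≤ ε → ε ≤ δ → x + ε • ptc 1 θ ∈ U := fun ε θ h0 h1 => hrU <| by
    rw [mem_ball_iff_norm, add_sub_cancel_left, norm_smul, norm_ptc_one, Real.norm_of_nonneg h0]
    linarith
  let c : ℝ → ℝ := fun ε => max 0 (min ε δ)
  have hc : Continuous c := by fun_prop
  have hcmem : ∀ q : ℝ × ℝ, x + c q.1 • ptc 1 q.2 ∈ U := fun q =>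
    hmem _ _ (le_max_left _ _) (max_le hδ0.le (min_le_right _ _))
  have he : Continuous fun q : ℝ × ℝ => ptc 1 q.2 := continuous_ptc_one.comp continuous_snd
  have hcq : Continuous fun q : ℝ × ℝ => c q.1 := hc.comp continuous_fst
  have hp : Continuous fun q : ℝ × ℝ => x + c q.1 • ptc 1 q.2 :=
    continuous_const.add (hcq.smul he)
  have hcu := hu.continuousOn.comp_continuous hp hcmem
  have hch := hh.continuousOn.comp_continuous hp hcmem
  have hcdu := ((hu.continuousOn_fderiv_of_isOpen hU le_rfl).comp_continuous hp hcmem).clm_apply he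
  have hcdh := ((hh.continuousOn_fderiv_of_isOpen hU le_rfl).comp_continuous hp hcmem).clm_apply he
  have hclog : Continuous fun q : ℝ × ℝ => ((c q.1 * Real.log (c q.1) : ℝ) : ℂ) :=
    Complex.continuous_ofReal.comp (Real.continuous_mul_log.comp hcq)
  have hcc : Continuous fun q : ℝ × ℝ => (c q.1 : ℂ) := Complex.continuous_ofReal.comp hcq
  let F : ℝ → ℝ → ℂ := fun ε θ =>
    a * u (x + c ε • ptc 1 θ)
      - (a * ((c ε * Real.log (c ε) : ℝ) : ℂ) + c ε * h (x + c ε • ptc 1 θ))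
        * fderiv ℝ u (x + c ε • ptc 1 θ) (ptc 1 θ)
      + c ε * fderiv ℝ h (x + c ε • ptc 1 θ) (ptc 1 θ) * u (x + c ε • ptc 1 θ)
  have hF : Continuous (Function.uncurry F) :=
    ((continuous_const.mul hcu).sub
      (((continuous_const.mul hclog).add (hcc.mul hch)).mul hcdu)).add ((hcc.mul hcdh).mul hcu)
  have hlim := (intervalIntegral.continuous_parametric_intervalIntegral_of_continuous'
    (μ := volume) hF 0 (2 * π)).tendsto 0
  have hc0 : c 0 = 0 := by simp [c]
  have hF0 : ∫ θ in (0:ℝ)..(2 * π), F 0 θ = ((2 * π : ℝ) : ℂ) * a * u x := by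
    simp [F, hc0]
    ring
  rw [hF0] at hlim
  refine (hlim.mono_left nhdsWithin_le_nhds).congr' ?_
  filter_upwards [Ioo_mem_nhdsGT hδ0] with ε hε
  refine intervalIntegral.integral_congr fun θ _ => ?_
  have hcε : c ε = ε := by simp [c, hε.1.le, hε.2.le]
  have hpU := hmem ε θ hε.1.le hε.2.le
  have hne : x + ε • ptc 1 θ ≠ x := by
    intro h0
    have := congrArg norm (add_eq_left.1 h0)
    rw [norm_smul, norm_ptc_one, norm_zero, mul_one, norm_eq_zero] at this
    exact hε.1.ne' this
  have hn : ‖x + ε • ptc 1 θ - x‖ = ε := by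
    rw [add_sub_cancel_left, norm_smul, norm_ptc_one, Real.norm_of_nonneg hε.1.le, mul_one]
  obtain ⟨L, hL, hLe⟩ := hasFDerivAt_log_norm_sub (x := x) hε.1 a (norm_ptc_one θ)
  have hhd : HasFDerivAt h (fderiv ℝ h (x + ε • ptc 1 θ)) (x + ε • ptc 1 θ) :=
    ((hh.differentiableOn one_ne_zero).differentiableAt (hU.mem_nhds hpU)).hasFDerivAt
  have hwd : HasFDerivAt w (L + fderiv ℝ h (x + ε • ptc 1 θ)) (x + ε • ptc 1 θ) :=
    (hL.add hhd).congr_of_eventuallyEq <| by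
      filter_upwards [(hU.sdiff isClosed_singleton).mem_nhds ⟨hpU, hne⟩] with ξ hξ
      exact hw ξ hξ
  have hε0 : (ε : ℂ) ≠ 0 := Complex.ofReal_ne_zero.2 hε.1.ne'
  simp only [F, hcε, hwd.fderiv, hw _ ⟨hpU, hne⟩, hn, map_neg, add_apply, hLe]
  push_cast
  field_simp
  ring

end
end

section
/- Let R > 0 and let x, z ∈ ℝ² with |x| < R, |z| < R, x₂ ≠ 0, z₂ ≠ 0 and x ≠ z. Let w₁, w₂ : ℝ² → ℂ be locally integrable functions such that w₁ is a distributional solution of Δw₁ + κ₀²w₁ = −δ_x and w₂ is a distributional solution of Δw₂ + κ₀²w₂ = −δ_z, and each wⱼ has the standard logarithmic singularity at its source point and is source-regular at its source point. Then ∫_{∂B_R} ( w₁(ξ) ∂_νw₂(ξ) − ∂_νw₁(ξ) w₂(ξ) ) ds(ξ) = w₂(x) − w₁(z). -/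
noncomputable section
open MeasureTheory Real Filter Topology

/-- w is a distributional solution of Δw + κ₀²w = −δ_y. -/
def IsPointSourceSol (κ1 κ2 : ℝ) (w : Pt → ℂ) (y : Pt) : Prop :=
  ∀ φ : Pt → ℂ, ContDiff ℝ (⊤ : ℕ∞) φ → HasCompactSupport φ →
    (∫ ξ : Pt, w ξ * (lap φ ξ + ((kappa0 κ1 κ2 ξ : ℝ) : ℂ) ^ 2 * φ ξ)) = -φ y

/-- w has the standard logarithmic singularity −(1/2π) log|ξ − y| at y. -/
def HasLogSingularity (w : Pt → ℂ) (y : Pt) : Prop :=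
  ∃ U : Set Pt, IsOpen U ∧ y ∈ U ∧ ∃ h : Pt → ℂ, ContDiffOn ℝ 1 h U ∧
    ∀ ξ ∈ U \ {y}, w ξ = -(((1 / (2 * π) : ℝ)) : ℂ) * (Real.log ‖ξ - y‖ : ℂ) + h ξ

/-- w is source-regular at y: C¹ off the source point, C² off the interface and source point. -/
def SourceRegular (w : Pt → ℂ) (y : Pt) : Prop :=
  ContDiffOn ℝ 1 w {y}ᶜ ∧ ContDiffOn ℝ 2 w ({x : Pt | 0 < x 1} \ {y}) ∧
    ContDiffOn ℝ 2 w ({x : Pt | x 1 < 0} \ {y})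

/-- w satisfies the two-layer radiation decay. -/
def RadiationDecay (κ1 κ2 : ℝ) (w : Pt → ℂ) : Prop :=
  ∃ C > (0:ℝ), ∃ ρ₀ > (0:ℝ), ∀ ξ : Pt, ρ₀ ≤ ‖ξ‖ →
    ‖w ξ‖ ≤ C * ‖ξ‖ ^ (-(1/2) : ℝ) ∧
    ‖dnu w ξ - Complex.I * ((kappa0 κ1 κ2 ξ : ℝ) : ℂ) * w ξ‖ ≤ C * ‖ξ‖ ^ (-(3/2) : ℝ)

/-- The bilinear product `∇u · ∇v`. -/
def gradDot (u v : Pt → ℂ) (ξ : Pt) : ℂ :=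
  fderiv ℝ u ξ (pt 1 0) * fderiv ℝ v ξ (pt 1 0) + fderiv ℝ u ξ (pt 0 1) * fderiv ℝ v ξ (pt 0 1)

lemma norm_pt_one_zero : ‖pt 1 0‖ = 1 := by
  simp [pt, EuclideanSpace.norm_eq, Fin.sum_univ_two]

lemma norm_pt_zero_one : ‖pt 0 1‖ = 1 := by
  simp [pt, EuclideanSpace.norm_eq, Fin.sum_univ_two]

lemma eq_smul_pt_add_smul_pt (v : Pt) : v = v 0 • pt 1 0 + v 1 • pt 0 1 := by
  ext i; fin_cases i <;> simp [pt]

lemma norm_fderiv_pt_one_zero_le (L : Pt →L[ℝ] ℂ) : ‖L (pt 1 0)‖ ≤ ‖L‖ := by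
  simpa [norm_pt_one_zero] using L.le_opNorm (pt 1 0)

lemma norm_fderiv_pt_zero_one_le (L : Pt →L[ℝ] ℂ) : ‖L (pt 0 1)‖ ≤ ‖L‖ := by
  simpa [norm_pt_zero_one] using L.le_opNorm (pt 0 1)

lemma norm_gradDot_le (u v : Pt → ℂ) (ξ : Pt) :
    ‖gradDot u v ξ‖ ≤ 2 * (‖fderiv ℝ u ξ‖ * ‖fderiv ℝ v ξ‖) := by
  unfold gradDot
  refine (norm_add_le _ _).trans ?_
  rw [norm_mul, norm_mul, two_mul]
  gcongr <;> first | apply norm_fderiv_pt_one_zero_le | apply norm_fderiv_pt_zero_one_le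

lemma norm_pt_sq (a b : ℝ) : ‖pt a b‖ ^ 2 = a ^ 2 + b ^ 2 := by
  simp [pt, EuclideanSpace.norm_sq_eq, Fin.sum_univ_two]

lemma norm_ptc (r θ : ℝ) : ‖ptc r θ‖ = |r| := by
  have h : ‖ptc r θ‖ ^ 2 = |r| ^ 2 := by
    rw [ptc, norm_pt_sq, sq_abs]
    linear_combination r ^ 2 * Real.sin_sq_add_cos_sq θ
  exact (pow_left_inj₀ (norm_nonneg _) (abs_nonneg _) two_ne_zero).1 h

lemma continuous_ptc : Continuous fun p : ℝ × ℝ => ptc p.1 p.2 := by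
  refine (PiLp.continuous_toLp 2 fun _ : Fin 2 => ℝ).comp (continuous_pi fun i => ?_)
  fin_cases i <;> simp <;> fun_prop

/-- The weight `1 + 1 / |ξ - y|`, which dominates a function with a logarithmic singularity at `y`
together with its gradient. -/
def poleWeight (y ξ : Pt) : ℝ := 1 + ‖ξ - y‖⁻¹

lemma one_le_poleWeight (y ξ : Pt) : 1 ≤ poleWeight y ξ := by
  unfold poleWeight; linarith [inv_nonneg.2 (norm_nonneg (ξ - y))]

lemma poleWeight_nonneg (y ξ : Pt) : 0 ≤ poleWeight y ξ := zero_le_one.trans (one_le_poleWeight y ξ)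

lemma measurable_poleWeight (y : Pt) : Measurable (poleWeight y) := by
  unfold poleWeight; fun_prop

lemma integrableOn_inv_norm (M : ℝ) :
    IntegrableOn (fun ξ : Pt => ‖ξ‖⁻¹) (Metric.closedBall 0 M) volume := by
  rw [← integrable_indicator_iff Metric.isClosed_closedBall.measurableSet]
  have h : (Metric.closedBall (0 : Pt) M).indicator (fun ξ : Pt => ‖ξ‖⁻¹)
      = fun ξ => (Set.Iic M).indicator (fun r : ℝ => r⁻¹) ‖ξ‖ := by
    ext ξ
    by_cases hM : ‖ξ‖ ≤ M
    · rw [Set.indicator_of_mem (mem_closedBall_zero_iff.2 hM), Set.indicator_of_mem (Set.mem_Iic.2 hM)]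
    · rw [Set.indicator_of_notMem (mt mem_closedBall_zero_iff.1 hM),
        Set.indicator_of_notMem (mt Set.mem_Iic.1 hM)]
  rw [h, integrable_fun_norm_addHaar]
  have h2 : IntegrableOn (fun _ : ℝ => (1 : ℝ)) (Set.Ioc 0 M) volume := by
    simp
  have h3 : IntegrableOn ((Set.Ioc 0 M).indicator fun _ : ℝ => (1 : ℝ)) (Set.Ioi 0) volume :=
    ((integrable_indicator_iff measurableSet_Ioc).2 h2).integrableOn
  refine h3.congr_fun (fun r hr => ?_) measurableSet_Ioi
  have hr' : (0 : ℝ) < r := hr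
  by_cases hM : r ≤ M <;> simp [hr', hM, hr'.ne']

lemma integrableOn_inv_norm_sub (y : Pt) (M : ℝ) :
    IntegrableOn (fun ξ : Pt => ‖ξ - y‖⁻¹) (Metric.closedBall 0 M) volume := by
  have h := (integrable_indicator_iff Metric.isClosed_closedBall.measurableSet).2
    (integrableOn_inv_norm (M + ‖y‖))
  have h2 := (h.comp_sub_right y).integrableOn (s := Metric.closedBall 0 M)
  refine h2.congr_fun (fun ξ hξ => ?_) Metric.isClosed_closedBall.measurableSet
  have h3 : ξ - y ∈ Metric.closedBall (0 : Pt) (M + ‖y‖) := by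
    rw [mem_closedBall_zero_iff] at hξ ⊢
    exact (norm_sub_le _ _).trans (by gcongr)
  simp only [Set.indicator_of_mem h3]

lemma poleWeight_mul_le {x z : Pt} (hxz : x ≠ z) {ξ : Pt} (hx : ξ ≠ x) (hz : ξ ≠ z) :
    poleWeight x ξ * poleWeight z ξ
      ≤ 1 + (1 + ‖x - z‖⁻¹) * (‖ξ - x‖⁻¹ + ‖ξ - z‖⁻¹) := by
  have ha : 0 < ‖ξ - x‖ := norm_pos_iff.2 (sub_ne_zero.2 hx)
  have hb : 0 < ‖ξ - z‖ := norm_pos_iff.2 (sub_ne_zero.2 hz)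
  have hd : 0 < ‖x - z‖ := norm_pos_iff.2 (sub_ne_zero.2 hxz)
  have htri : ‖x - z‖ ≤ ‖ξ - x‖ + ‖ξ - z‖ := by
    have := norm_sub_le (ξ - z) (ξ - x)
    rw [sub_sub_sub_cancel_left] at this
    linarith
  have key : ‖ξ - x‖⁻¹ * ‖ξ - z‖⁻¹ ≤ ‖x - z‖⁻¹ * (‖ξ - x‖⁻¹ + ‖ξ - z‖⁻¹) := by
    have h : ‖x - z‖⁻¹ * (‖ξ - x‖⁻¹ + ‖ξ - z‖⁻¹)
        = ((‖ξ - x‖ + ‖ξ - z‖) / ‖x - z‖) * (‖ξ - x‖⁻¹ * ‖ξ - z‖⁻¹) := by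
      field_simp; ring
    rw [h]
    exact le_mul_of_one_le_left (by positivity) ((one_le_div hd).2 htri)
  unfold poleWeight
  linarith

lemma integrableOn_poleWeight_mul {x z : Pt} (hxz : x ≠ z) (M : ℝ) :
    IntegrableOn (fun ξ => poleWeight x ξ * poleWeight z ξ) (Metric.closedBall 0 M) volume := by
  have h1 : IntegrableOn (fun ξ : Pt => 1 + (1 + ‖x - z‖⁻¹) * (‖ξ - x‖⁻¹ + ‖ξ - z‖⁻¹))
      (Metric.closedBall 0 M) volume := by
    refine Integrable.add ?_ (((integrableOn_inv_norm_sub x M).add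
      (integrableOn_inv_norm_sub z M)).const_mul _)
    exact continuous_const.continuousOn.integrableOn_compact (isCompact_closedBall _ _)
  refine h1.mono' ((measurable_poleWeight x).mul (measurable_poleWeight z)).aestronglyMeasurable
    (ae_restrict_of_ae ?_)
  have hx : ∀ᵐ ξ : Pt, ξ ≠ x := Measure.ae_ne volume x
  have hz : ∀ᵐ ξ : Pt, ξ ≠ z := Measure.ae_ne volume z
  filter_upwards [hx, hz] with ξ h1 h2
  rw [Real.norm_of_nonneg (mul_nonneg (poleWeight_nonneg _ _) (poleWeight_nonneg _ _))]
  exact poleWeight_mul_le hxz h1 h2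

/-- Dominated convergence with two distinct poles. -/
lemma tendsto_integral_of_poleWeight_bound {x z : Pt} (hxz : x ≠ z) {F : ℕ → Pt → ℂ} {f : Pt → ℂ}
    {M C : ℝ} (hmeas : ∀ n, AEStronglyMeasurable (F n) volume)
    (hb : ∀ n ξ, ‖ξ‖ ≤ M → ξ ≠ x → ξ ≠ z → ‖F n ξ‖ ≤ C * (poleWeight x ξ * poleWeight z ξ))
    (hsupp : ∀ n ξ, M < ‖ξ‖ → F n ξ = 0)
    (hlim : ∀ ξ, ξ ≠ x → ξ ≠ z → Tendsto (fun n => F n ξ) atTop (𝓝 (f ξ))) :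
    Integrable f volume ∧ Tendsto (fun n => ∫ ξ, F n ξ) atTop (𝓝 (∫ ξ, f ξ)) := by
  have hx : ∀ᵐ ξ : Pt, ξ ≠ x := Measure.ae_ne volume x
  have hz : ∀ᵐ ξ : Pt, ξ ≠ z := Measure.ae_ne volume z
  set b : Pt → ℝ := (Metric.closedBall 0 M).indicator
    fun ξ => C * (poleWeight x ξ * poleWeight z ξ) with hbdef
  have hbi : Integrable b volume :=
    (integrable_indicator_iff Metric.isClosed_closedBall.measurableSet).2
      ((integrableOn_poleWeight_mul hxz M).const_mul C)
  have hFb : ∀ n, ∀ᵐ ξ, ‖F n ξ‖ ≤ b ξ := by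
    intro n
    filter_upwards [hx, hz] with ξ h1 h2
    by_cases h : ‖ξ‖ ≤ M
    · simpa [hbdef, Set.indicator_apply, h] using hb n ξ h h1 h2
    · simp [hbdef, h, hsupp n ξ (not_le.1 h)]
  have hl : ∀ᵐ ξ, Tendsto (fun n => F n ξ) atTop (𝓝 (f ξ)) := by
    filter_upwards [hx, hz] with ξ h1 h2 using hlim ξ h1 h2
  refine ⟨⟨aestronglyMeasurable_of_tendsto_ae _ hmeas hl,
    hasFiniteIntegral_of_dominated_convergence hbi.2 hFb hl⟩,
    tendsto_integral_of_dominated_convergence b hmeas hbi hFb hl⟩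

/-- The regularized logarithm `-(1/(4π)) log(|ξ - y|² + ε)`. -/
def logReg (y : Pt) (ε : ℝ) (ξ : Pt) : ℂ :=
  ((-(1 / (2 * π)) * (1 / 2 * Real.log (‖ξ - y‖ ^ 2 + ε)) : ℝ) : ℂ)

/-- The derivative of the regularized logarithm. -/
def logRegDeriv (y : Pt) (ε : ℝ) (ξ : Pt) : Pt →L[ℝ] ℂ :=
  (-(1 / (2 * π)) * (‖ξ - y‖ ^ 2 + ε)⁻¹) • (Complex.ofRealCLM.comp (innerSL ℝ (ξ - y)))

lemma hasFDerivAt_logReg {y : Pt} {ε : ℝ} {ξ : Pt} (h : ‖ξ - y‖ ^ 2 + ε ≠ 0) :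
    HasFDerivAt (logReg y ε) (logRegDeriv y ε ξ) ξ := by
  have h1 : HasFDerivAt (fun ξ : Pt => ‖ξ - y‖ ^ 2 + ε) _ ξ :=
    (((hasFDerivAt_id ξ).sub_const y).norm_sq).add_const ε
  have h2 := ((h1.log h).const_mul (1 / 2)).const_mul (-(1 / (2 * π)))
  have h3 := Complex.ofRealCLM.hasFDerivAt.comp ξ h2
  refine h3.congr_fderiv ?_
  ext v
  simp [logRegDeriv]
  ring

lemma contDiffAt_logReg {y : Pt} {ε : ℝ} {ξ : Pt} (h : ‖ξ - y‖ ^ 2 + ε ≠ 0) :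
    ContDiffAt ℝ 1 (logReg y ε) ξ := by
  unfold logReg
  refine Complex.ofRealCLM.contDiff.contDiffAt.comp ξ ?_
  refine contDiffAt_const.mul (contDiffAt_const.mul (ContDiffAt.log ?_ h))
  exact (((contDiff_id.sub contDiff_const).norm_sq ℝ).add contDiff_const).contDiffAt

lemma logReg_zero (y ξ : Pt) :
    logReg y 0 ξ = -(((1 / (2 * π) : ℝ)) : ℂ) * (Real.log ‖ξ - y‖ : ℂ) := by
  unfold logReg
  rw [add_zero, Real.log_pow]
  push_cast
  ring

lemma one_div_two_pi_le_one : 1 / (2 * π) ≤ 1 := by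
  rw [div_le_one (by positivity)]
  linarith [Real.pi_gt_three]

lemma norm_logRegDeriv_le (y : Pt) {ε : ℝ} (hε : 0 ≤ ε) (ξ : Pt) :
    ‖logRegDeriv y ε ξ‖ ≤ ‖ξ - y‖⁻¹ := by
  unfold logRegDeriv
  have h1 : ‖Complex.ofRealCLM.comp (innerSL ℝ (ξ - y))‖ ≤ ‖ξ - y‖ := by
    refine (ContinuousLinearMap.opNorm_comp_le _ _).trans ?_
    rw [Complex.ofRealCLM_norm, one_mul, innerSL_apply_norm]
  rw [norm_smul, norm_mul, norm_neg, Real.norm_of_nonneg (by positivity),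
    Real.norm_of_nonneg (by positivity)]
  rcases eq_or_lt_of_le (norm_nonneg (ξ - y)) with h0 | h0
  · rw [← h0] at h1 ⊢
    rw [le_antisymm h1 (norm_nonneg _)]
    simp
  · calc 1 / (2 * π) * (‖ξ - y‖ ^ 2 + ε)⁻¹ * ‖Complex.ofRealCLM.comp (innerSL ℝ (ξ - y))‖
        ≤ 1 * (‖ξ - y‖ ^ 2)⁻¹ * ‖ξ - y‖ := by
          gcongr
          · exact one_div_two_pi_le_one
          · linarith
      _ = ‖ξ - y‖⁻¹ := by field_simp

lemma norm_logReg_le (y : Pt) {ε : ℝ} (hε : 0 ≤ ε) (hε1 : ε ≤ 1) {ξ : Pt} (hξ : ξ ≠ y) :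
    ‖logReg y ε ξ‖ ≤ ‖ξ - y‖ ^ 2 + 2 * ‖ξ - y‖⁻¹ := by
  have ht : 0 < ‖ξ - y‖ := norm_pos_iff.2 (sub_ne_zero.2 hξ)
  set t := ‖ξ - y‖
  have hup : Real.log (t ^ 2 + ε) ≤ t ^ 2 := by
    linarith [Real.log_le_sub_one_of_pos (show 0 < t ^ 2 + ε by positivity)]
  have hlo : -(2 * t⁻¹) ≤ Real.log (t ^ 2 + ε) := by
    have h1 : Real.log (t ^ 2) ≤ Real.log (t ^ 2 + ε) :=
      Real.log_le_log (by positivity) (by linarith)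
    have h2 := Real.log_le_sub_one_of_pos (inv_pos.2 ht)
    rw [Real.log_inv] at h2
    rw [Real.log_pow] at h1
    push_cast at h1
    linarith
  have habs : |Real.log (t ^ 2 + ε)| ≤ t ^ 2 + 2 * t⁻¹ := by
    have := inv_pos.2 ht
    rw [abs_le]; constructor <;> nlinarith
  unfold logReg
  rw [Complex.norm_real, norm_mul, norm_mul, norm_neg, Real.norm_of_nonneg (by positivity),
    Real.norm_of_nonneg (by positivity), Real.norm_eq_abs]
  calc 1 / (2 * π) * (1 / 2 * |Real.log (t ^ 2 + ε)|)
      ≤ 1 * (1 * |Real.log (t ^ 2 + ε)|) := by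
        gcongr
        · exact one_div_two_pi_le_one
        · norm_num
    _ ≤ _ := by simpa using habs

lemma tendsto_logReg {y ξ : Pt} (hξ : ξ ≠ y) {ε : ℕ → ℝ} (hε : Tendsto ε atTop (𝓝 0)) :
    Tendsto (fun n => logReg y (ε n) ξ) atTop (𝓝 (logReg y 0 ξ)) := by
  have ht : 0 < ‖ξ - y‖ := norm_pos_iff.2 (sub_ne_zero.2 hξ)
  unfold logReg
  refine (Complex.continuous_ofReal.tendsto _).comp ?_
  refine ((Tendsto.log ?_ (by positivity)).const_mul _).const_mul _
  exact tendsto_const_nhds.add hε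

lemma tendsto_logRegDeriv {y ξ : Pt} (hξ : ξ ≠ y) {ε : ℕ → ℝ} (hε : Tendsto ε atTop (𝓝 0)) :
    Tendsto (fun n => logRegDeriv y (ε n) ξ) atTop (𝓝 (logRegDeriv y 0 ξ)) := by
  have ht : 0 < ‖ξ - y‖ := norm_pos_iff.2 (sub_ne_zero.2 hξ)
  unfold logRegDeriv
  refine Tendsto.smul_const (((Tendsto.inv₀ ?_ (by positivity))).const_mul _) _
  exact tendsto_const_nhds.add hε

/-- A sequence of `C¹` functions converging to `w` together with its derivative away from `y`,
dominated on bounded sets by the weight `poleWeight y`. -/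
structure PoleApprox (w : Pt → ℂ) (y : Pt) (u : ℕ → Pt → ℂ) : Prop where
  contDiff : ∀ n, ContDiff ℝ 1 (u n)
  tendsto : ∀ ξ, ξ ≠ y → Tendsto (fun n => u n ξ) atTop (𝓝 (w ξ))
  tendsto_fderiv : ∀ ξ, ξ ≠ y →
    Tendsto (fun n => fderiv ℝ (u n) ξ) atTop (𝓝 (fderiv ℝ w ξ))
  bound : ∀ M : ℝ, ∃ C : ℝ, 0 ≤ C ∧ ∀ n ξ, ‖ξ‖ ≤ M → ξ ≠ y →
    ‖u n ξ‖ ≤ C * poleWeight y ξ ∧ ‖fderiv ℝ (u n) ξ‖ ≤ C * poleWeight y ξ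

lemma HasLogSingularity.exists_contDiff {w : Pt → ℂ} {y : Pt} (hs : HasLogSingularity w y)
    (hw : ContDiffOn ℝ 1 w {y}ᶜ) :
    ∃ h : Pt → ℂ, ContDiff ℝ 1 h ∧ ∀ ξ, ξ ≠ y → w ξ = logReg y 0 ξ + h ξ := by
  classical
  obtain ⟨U, hU, hyU, g, hg, hgw⟩ := hs
  refine ⟨Function.update (fun ξ => w ξ - logReg y 0 ξ) y (g y), ?_, fun ξ hξ => ?_⟩
  · rw [contDiff_iff_contDiffAt]
    intro ξ
    by_cases hξ : ξ = y
    · subst hξ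
      refine (hg.contDiffAt (hU.mem_nhds hyU)).congr_of_eventuallyEq ?_
      filter_upwards [hU.mem_nhds hyU] with ζ hζ
      by_cases h : ζ = ξ
      · simp [h]
      · rw [Function.update_of_ne h, hgw ζ ⟨hζ, h⟩, logReg_zero]
        ring
    · have hn : {y}ᶜ ∈ 𝓝 ξ := isOpen_compl_singleton.mem_nhds hξ
      have ht : 0 < ‖ξ - y‖ := norm_pos_iff.2 (sub_ne_zero.2 hξ)
      refine ((hw.contDiffAt hn).sub
        (contDiffAt_logReg (y := y) (ε := 0) (by positivity))).congr_of_eventuallyEq ?_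
      filter_upwards [hn] with ζ hζ
      rw [Function.update_of_ne hζ]
  · rw [Function.update_of_ne hξ]
    ring

lemma exists_poleApprox {w : Pt → ℂ} {y : Pt} (hs : HasLogSingularity w y)
    (hw : ContDiffOn ℝ 1 w {y}ᶜ) : ∃ u, PoleApprox w y u := by
  obtain ⟨h, hh, hwh⟩ := hs.exists_contDiff hw
  set ε : ℕ → ℝ := fun n => 1 / ((n : ℝ) + 1) with hεdef
  have hε0 : ∀ n, 0 < ε n := fun n => by simp only [hεdef]; positivity
  have hε1 : ∀ n, ε n ≤ 1 := fun n => by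
    simp only [hεdef]
    rw [div_le_one (by positivity)]
    linarith [(Nat.cast_nonneg n : (0 : ℝ) ≤ n)]
  have hε : Tendsto ε atTop (𝓝 0) := tendsto_one_div_add_atTop_nhds_zero_nat
  have hpos : ∀ n ξ, ‖ξ - y‖ ^ 2 + ε n ≠ 0 := fun n ξ => by have := hε0 n; positivity
  have hd : ∀ n ξ, fderiv ℝ (fun ζ => logReg y (ε n) ζ + h ζ) ξ
      = logRegDeriv y (ε n) ξ + fderiv ℝ h ξ := fun n ξ =>
    ((hasFDerivAt_logReg (hpos n ξ)).add
      (hh.differentiable one_ne_zero ξ).hasFDerivAt).fderiv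
  refine ⟨fun n ξ => logReg y (ε n) ξ + h ξ, ?_, ?_, ?_, ?_⟩
  · exact fun n => (contDiff_iff_contDiffAt.2 fun ξ => contDiffAt_logReg (hpos n ξ)).add hh
  · intro ξ hξ
    rw [hwh ξ hξ]
    exact (tendsto_logReg hξ hε).add_const _
  · intro ξ hξ
    have ht : 0 < ‖ξ - y‖ := norm_pos_iff.2 (sub_ne_zero.2 hξ)
    have hwd : fderiv ℝ w ξ = logRegDeriv y 0 ξ + fderiv ℝ h ξ := by
      refine HasFDerivAt.fderiv (HasFDerivAt.congr_of_eventuallyEq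
        ((hasFDerivAt_logReg (y := y) (ε := 0) (by positivity)).add
          (hh.differentiable one_ne_zero ξ).hasFDerivAt) ?_)
      filter_upwards [isOpen_compl_singleton.mem_nhds hξ] with ζ hζ using hwh ζ hζ
    simp only [hd, hwd]
    exact (tendsto_logRegDeriv hξ hε).add_const _
  · intro M
    obtain ⟨A, hA⟩ := (isCompact_closedBall (0 : Pt) M).exists_bound_of_continuousOn
      hh.continuous.continuousOn
    obtain ⟨B, hB⟩ := (isCompact_closedBall (0 : Pt) M).exists_bound_of_continuousOn
      (hh.continuous_fderiv one_ne_zero).continuousOn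
    refine ⟨(|M| + ‖y‖) ^ 2 + 2 + |A| + |B|, by positivity, fun n ξ hM hξ => ⟨?_, ?_⟩⟩
    · have h1 := norm_logReg_le y (hε0 n).le (hε1 n) hξ
      have h2 := hA ξ (mem_closedBall_zero_iff.2 hM)
      have h3 : ‖ξ - y‖ ^ 2 ≤ (|M| + ‖y‖) ^ 2 := by
        gcongr
        exact (norm_sub_le _ _).trans (by gcongr; exact hM.trans (le_abs_self M))
      have h4 := inv_nonneg.2 (norm_nonneg (ξ - y))
      have h5 : ‖logReg y (ε n) ξ + h ξ‖ ≤ _ := norm_add_le _ _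
      unfold poleWeight
      nlinarith [le_abs_self A, abs_nonneg A, abs_nonneg B, sq_nonneg (|M| + ‖y‖),
        mul_nonneg (sq_nonneg (|M| + ‖y‖)) h4, mul_nonneg (abs_nonneg A) h4,
        mul_nonneg (abs_nonneg B) h4]
    · have h1 := norm_logRegDeriv_le y (hε0 n).le ξ
      have h2 := hB ξ (mem_closedBall_zero_iff.2 hM)
      have h4 := inv_nonneg.2 (norm_nonneg (ξ - y))
      rw [hd]
      have h5 := norm_add_le (logRegDeriv y (ε n) ξ) (fderiv ℝ h ξ)
      unfold poleWeight
      nlinarith [le_abs_self B, abs_nonneg A, abs_nonneg B, sq_nonneg (|M| + ‖y‖),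
        mul_nonneg (sq_nonneg (|M| + ‖y‖)) h4, mul_nonneg (abs_nonneg A) h4,
        mul_nonneg (abs_nonneg B) h4]

lemma PoleApprox.aestronglyMeasurable {w : Pt → ℂ} {y : Pt} {u : ℕ → Pt → ℂ}
    (hu : PoleApprox w y u) : AEStronglyMeasurable w volume :=
  aestronglyMeasurable_of_tendsto_ae _ (fun n => (hu.contDiff n).continuous.aestronglyMeasurable)
    (by filter_upwards [Measure.ae_ne volume y] with ξ hξ using hu.tendsto ξ hξ)

lemma PoleApprox.aestronglyMeasurable_fderiv {w : Pt → ℂ} {y : Pt} {u : ℕ → Pt → ℂ}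
    (hu : PoleApprox w y u) : AEStronglyMeasurable (fderiv ℝ w) volume :=
  aestronglyMeasurable_of_tendsto_ae _
    (fun n => ((hu.contDiff n).continuous_fderiv one_ne_zero).aestronglyMeasurable)
    (by filter_upwards [Measure.ae_ne volume y] with ξ hξ using hu.tendsto_fderiv ξ hξ)

lemma PoleApprox.bound_limit {w : Pt → ℂ} {y : Pt} {u : ℕ → Pt → ℂ}
    (hu : PoleApprox w y u) (M : ℝ) : ∃ C : ℝ, 0 ≤ C ∧ ∀ ξ, ‖ξ‖ ≤ M → ξ ≠ y →
    ‖w ξ‖ ≤ C * poleWeight y ξ ∧ ‖fderiv ℝ w ξ‖ ≤ C * poleWeight y ξ := by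
  obtain ⟨C, hC, hb⟩ := hu.bound M
  refine ⟨C, hC, fun ξ hM hξ => ⟨?_, ?_⟩⟩
  · exact le_of_tendsto (hu.tendsto ξ hξ).norm (.of_forall fun n => (hb n ξ hM hξ).1)
  · exact le_of_tendsto (hu.tendsto_fderiv ξ hξ).norm (.of_forall fun n => (hb n ξ hM hξ).2)

/-- The integrand `κ₀² w φ - ∇w · ∇φ` of the first-order weak formulation. -/
def weakIntegrand (κ1 κ2 : ℝ) (w φ : Pt → ℂ) (ξ : Pt) : ℂ :=
  ((kappa0 κ1 κ2 ξ : ℝ) : ℂ) ^ 2 * (w ξ * φ ξ) - gradDot w φ ξ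

lemma measurable_kappa0 (κ1 κ2 : ℝ) : Measurable (kappa0 κ1 κ2) := by
  unfold kappa0
  refine Measurable.ite (measurableSet_lt measurable_const ?_) measurable_const measurable_const
  exact (by fun_prop : Continuous fun ξ : Pt => ξ 1).measurable

lemma norm_kappa0_sq_le (κ1 κ2 : ℝ) (ξ : Pt) :
    ‖((kappa0 κ1 κ2 ξ : ℝ) : ℂ) ^ 2‖ ≤ κ1 ^ 2 + κ2 ^ 2 := by
  rw [norm_pow, Complex.norm_real, Real.norm_eq_abs, sq_abs]
  unfold kappa0
  split_ifs <;> nlinarith [sq_nonneg κ1, sq_nonneg κ2]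

lemma aestronglyMeasurable_gradDot {u v : Pt → ℂ}
    (hu : AEStronglyMeasurable (fderiv ℝ u) volume)
    (hv : AEStronglyMeasurable (fderiv ℝ v) volume) :
    AEStronglyMeasurable (gradDot u v) volume :=
  ((hu.apply_continuousLinearMap _).mul (hv.apply_continuousLinearMap _)).add
    ((hu.apply_continuousLinearMap _).mul (hv.apply_continuousLinearMap _))

lemma aestronglyMeasurable_weakIntegrand (κ1 κ2 : ℝ) {u v : Pt → ℂ}
    (hu : AEStronglyMeasurable u volume) (hu' : AEStronglyMeasurable (fderiv ℝ u) volume)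
    (hv : AEStronglyMeasurable v volume) (hv' : AEStronglyMeasurable (fderiv ℝ v) volume) :
    AEStronglyMeasurable (weakIntegrand κ1 κ2 u v) volume := by
  have hk : Measurable fun ξ => ((kappa0 κ1 κ2 ξ : ℝ) : ℂ) ^ 2 :=
    (Complex.measurable_ofReal.comp (measurable_kappa0 κ1 κ2)).pow_const 2
  exact (hk.aestronglyMeasurable.mul (hu.mul hv)).sub (aestronglyMeasurable_gradDot hu' hv')

lemma norm_weakIntegrand_le (κ1 κ2 : ℝ) {u v : Pt → ℂ} {ξ : Pt} {a b : ℝ}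
    (hu : ‖u ξ‖ ≤ a) (hu' : ‖fderiv ℝ u ξ‖ ≤ a) (hv : ‖v ξ‖ ≤ b) (hv' : ‖fderiv ℝ v ξ‖ ≤ b) :
    ‖weakIntegrand κ1 κ2 u v ξ‖ ≤ (κ1 ^ 2 + κ2 ^ 2 + 2) * (a * b) := by
  have ha : 0 ≤ a := (norm_nonneg _).trans hu
  have h1 : ‖((kappa0 κ1 κ2 ξ : ℝ) : ℂ) ^ 2 * (u ξ * v ξ)‖ ≤ (κ1 ^ 2 + κ2 ^ 2) * (a * b) := by
    rw [norm_mul, norm_mul]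
    gcongr
    exact norm_kappa0_sq_le κ1 κ2 ξ
  have h2 : ‖gradDot u v ξ‖ ≤ 2 * (a * b) := (norm_gradDot_le u v ξ).trans (by gcongr)
  refine (norm_sub_le _ _).trans ?_
  linarith

lemma tendsto_gradDot {u v : ℕ → Pt → ℂ} {a b : Pt → ℂ} {ξ : Pt}
    (hu : Tendsto (fun n => fderiv ℝ (u n) ξ) atTop (𝓝 (fderiv ℝ a ξ)))
    (hv : Tendsto (fun n => fderiv ℝ (v n) ξ) atTop (𝓝 (fderiv ℝ b ξ))) :
    Tendsto (fun n => gradDot (u n) (v n) ξ) atTop (𝓝 (gradDot a b ξ)) := by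
  have h {f : ℕ → Pt →L[ℝ] ℂ} {g : Pt →L[ℝ] ℂ} (hf : Tendsto f atTop (𝓝 g)) (e : Pt) :
      Tendsto (fun n => f n e) atTop (𝓝 (g e)) :=
    ((ContinuousLinearMap.apply ℝ ℂ e).continuous.tendsto g).comp hf
  exact ((h hu _).mul (h hv _)).add ((h hu _).mul (h hv _))

lemma tendsto_integral_weakIntegrand (κ1 κ2 : ℝ) {x z : Pt} (hxz : x ≠ z)
    {u v : ℕ → Pt → ℂ} {a b : Pt → ℂ} {M A B : ℝ}
    (hum : ∀ n, AEStronglyMeasurable (u n) volume)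
    (hum' : ∀ n, AEStronglyMeasurable (fderiv ℝ (u n)) volume)
    (hvm : ∀ n, AEStronglyMeasurable (v n) volume)
    (hvm' : ∀ n, AEStronglyMeasurable (fderiv ℝ (v n)) volume)
    (hub : ∀ n ξ, ‖ξ‖ ≤ M → ξ ≠ x →
      ‖u n ξ‖ ≤ A * poleWeight x ξ ∧ ‖fderiv ℝ (u n) ξ‖ ≤ A * poleWeight x ξ)
    (hvb : ∀ n ξ, ‖ξ‖ ≤ M → ξ ≠ z →
      ‖v n ξ‖ ≤ B * poleWeight z ξ ∧ ‖fderiv ℝ (v n) ξ‖ ≤ B * poleWeight z ξ)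
    (hv0 : ∀ n ξ, M < ‖ξ‖ → v n ξ = 0 ∧ fderiv ℝ (v n) ξ = 0)
    (hul : ∀ ξ, ξ ≠ x → Tendsto (fun n => u n ξ) atTop (𝓝 (a ξ)))
    (hul' : ∀ ξ, ξ ≠ x → Tendsto (fun n => fderiv ℝ (u n) ξ) atTop (𝓝 (fderiv ℝ a ξ)))
    (hvl : ∀ ξ, ξ ≠ z → Tendsto (fun n => v n ξ) atTop (𝓝 (b ξ)))
    (hvl' : ∀ ξ, ξ ≠ z → Tendsto (fun n => fderiv ℝ (v n) ξ) atTop (𝓝 (fderiv ℝ b ξ))) :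
    Integrable (weakIntegrand κ1 κ2 a b) volume ∧
      Tendsto (fun n => ∫ ξ, weakIntegrand κ1 κ2 (u n) (v n) ξ) atTop
        (𝓝 (∫ ξ, weakIntegrand κ1 κ2 a b ξ)) := by
  refine tendsto_integral_of_poleWeight_bound hxz (M := M)
    (C := (κ1 ^ 2 + κ2 ^ 2 + 2) * (A * B)) (fun n => aestronglyMeasurable_weakIntegrand κ1 κ2
      (hum n) (hum' n) (hvm n) (hvm' n)) ?_ ?_ ?_
  · intro n ξ hM hx hz
    refine (norm_weakIntegrand_le κ1 κ2 (hub n ξ hM hx).1 (hub n ξ hM hx).2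
      (hvb n ξ hM hz).1 (hvb n ξ hM hz).2).trans (le_of_eq ?_)
    ring
  · intro n ξ hM
    simp [weakIntegrand, gradDot, hv0 n ξ hM]
  · intro ξ hx hz
    exact (((hul ξ hx).mul (hvl ξ hz)).const_mul _).sub (tendsto_gradDot (hul' ξ hx) (hvl' ξ hz))

lemma HasCompactSupport.exists_radius {φ : Pt → ℂ} (hφ : HasCompactSupport φ) :
    ∃ M : ℝ, ∀ ξ, M < ‖ξ‖ → ξ ∉ tsupport φ := by
  obtain ⟨M, hM⟩ := hφ.isBounded.subset_closedBall 0
  exact ⟨M, fun ξ hξ h => absurd (mem_closedBall_zero_iff.1 (hM h)) (not_le.2 hξ)⟩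

lemma fderiv_eq_zero_of_notMem_tsupport {φ : Pt → ℂ} {ξ : Pt} (h : ξ ∉ tsupport φ) :
    fderiv ℝ φ ξ = 0 := by
  by_contra h'
  exact h (support_fderiv_subset ℝ h')

lemma lap_eq_zero_of_notMem_tsupport {φ : Pt → ℂ} {ξ : Pt} (h : ξ ∉ tsupport φ) :
    lap φ ξ = 0 := by
  unfold lap
  rw [fderiv_eq_zero_of_notMem_tsupport fun h' => h (tsupport_fderiv_apply_subset ℝ _ h'),
    fderiv_eq_zero_of_notMem_tsupport fun h' => h (tsupport_fderiv_apply_subset ℝ _ h')]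
  simp

lemma exists_bound_of_contDiff {φ : Pt → ℂ} (hφ : ContDiff ℝ 1 φ) (hc : HasCompactSupport φ) :
    ∃ B : ℝ, 0 ≤ B ∧ ∀ ξ, ‖φ ξ‖ ≤ B ∧ ‖fderiv ℝ φ ξ‖ ≤ B := by
  obtain ⟨B1, h1⟩ := hc.exists_bound_of_continuous hφ.continuous
  obtain ⟨B2, h2⟩ := (hc.fderiv ℝ).exists_bound_of_continuous (hφ.continuous_fderiv one_ne_zero)
  exact ⟨max B1 B2, ((norm_nonneg _).trans (h1 0)).trans (le_max_left _ _),
    fun ξ => ⟨(h1 ξ).trans (le_max_left _ _), (h2 ξ).trans (le_max_right _ _)⟩⟩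

lemma continuous_lap {φ : Pt → ℂ} (hφ : ContDiff ℝ 2 φ) : Continuous (lap φ) := by
  have h (v : Pt) : Continuous fun ξ => fderiv ℝ (fun y => fderiv ℝ φ y v) ξ v :=
    (((hφ.fderiv_right (m := 1) (by norm_num)).clm_apply contDiff_const).continuous_fderiv
      one_ne_zero).clm_apply continuous_const
  exact (h _).add (h _)

lemma integral_mul_lap {u φ : Pt → ℂ} (hu : ContDiff ℝ 1 u) (hφ : ContDiff ℝ 2 φ)
    (hc : HasCompactSupport φ) : ∫ ξ, u ξ * lap φ ξ = -∫ ξ, gradDot u φ ξ := by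
  have hu' (v : Pt) : Continuous fun ξ => fderiv ℝ u ξ v :=
    (hu.continuous_fderiv one_ne_zero).clm_apply continuous_const
  have hD (v : Pt) : ContDiff ℝ 1 fun y => fderiv ℝ φ y v :=
    (hφ.fderiv_right (m := 1) (by norm_num)).clm_apply contDiff_const
  have hDc (v : Pt) : HasCompactSupport fun y => fderiv ℝ φ y v := hc.fderiv_apply ℝ v
  have hi1 (v : Pt) : Integrable (fun ξ => fderiv ℝ u ξ v * fderiv ℝ φ ξ v) volume :=
    ((hu' v).mul (hD v).continuous).integrable_of_hasCompactSupport (hDc v).mul_left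
  have hi2 (v : Pt) :
      Integrable (fun ξ => u ξ * fderiv ℝ (fun y => fderiv ℝ φ y v) ξ v) volume :=
    (hu.continuous.mul (((hD v).continuous_fderiv one_ne_zero).clm_apply
      continuous_const)).integrable_of_hasCompactSupport ((hDc v).fderiv_apply ℝ v).mul_left
  have hi3 (v : Pt) : Integrable (fun ξ => u ξ * fderiv ℝ φ ξ v) volume :=
    (hu.continuous.mul (hD v).continuous).integrable_of_hasCompactSupport (hDc v).mul_left
  have key (v : Pt) := integral_mul_fderiv_eq_neg_fderiv_mul_of_integrable (hi1 v) (hi2 v) (hi3 v)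
    (fun ξ _ => hu.differentiable one_ne_zero ξ) (fun ξ _ => (hD v).differentiable one_ne_zero ξ)
  simp only [lap, gradDot, mul_add]
  rw [integral_add (hi2 _) (hi2 _), integral_add (hi1 _) (hi1 _), key, key]
  ring

lemma exists_ne_pt (y : Pt) : ∃ z : Pt, y ≠ z := (exists_ne y).imp fun _ h => h.symm

/-- The first-order weak formulation, for smooth test functions. -/
lemma IsPointSourceSol.integral_weakIntegrand_smooth {κ1 κ2 : ℝ} {w : Pt → ℂ} {y : Pt}
    (hw : IsPointSourceSol κ1 κ2 w y) {u : ℕ → Pt → ℂ} (hu : PoleApprox w y u)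
    {φ : Pt → ℂ} (hφ : ContDiff ℝ (⊤ : ℕ∞) φ) (hc : HasCompactSupport φ) :
    ∫ ξ, weakIntegrand κ1 κ2 w φ ξ = -φ y := by
  obtain ⟨z, hyz⟩ := exists_ne_pt y
  obtain ⟨M, hM⟩ := hc.exists_radius
  obtain ⟨A, hA, hub⟩ := hu.bound M
  have hφ2 : ContDiff ℝ 2 φ := contDiff_infty.1 hφ 2
  have hφ1 : ContDiff ℝ 1 φ := contDiff_infty.1 hφ 1
  obtain ⟨B, hB, hφb⟩ := exists_bound_of_contDiff hφ1 hc
  have hlapc : HasCompactSupport (lap φ) :=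
    HasCompactSupport.intro hc fun ξ => lap_eq_zero_of_notMem_tsupport
  obtain ⟨B', hB'⟩ := hlapc.exists_bound_of_continuous (continuous_lap hφ2)
  have hB'0 : 0 ≤ B' := (norm_nonneg _).trans (hB' 0)
  have hk : Measurable fun ξ => ((kappa0 κ1 κ2 ξ : ℝ) : ℂ) ^ 2 :=
    (Complex.measurable_ofReal.comp (measurable_kappa0 κ1 κ2)).pow_const 2
  have hz1 (ξ : Pt) : B ≤ B * poleWeight z ξ := le_mul_of_one_le_right hB (one_le_poleWeight z ξ)
  have lim1 := (tendsto_integral_weakIntegrand κ1 κ2 hyz (u := u) (v := fun _ => φ) (a := w)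
    (b := φ) (M := M) (A := A) (B := B) (fun n => (hu.contDiff n).continuous.aestronglyMeasurable)
    (fun n => ((hu.contDiff n).continuous_fderiv one_ne_zero).aestronglyMeasurable)
    (fun _ => hφ1.continuous.aestronglyMeasurable)
    (fun _ => (hφ1.continuous_fderiv one_ne_zero).aestronglyMeasurable)
    hub (fun _ ξ _ _ => ⟨(hφb ξ).1.trans (hz1 ξ), (hφb ξ).2.trans (hz1 ξ)⟩)
    (fun _ ξ h => ⟨image_eq_zero_of_notMem_tsupport (hM ξ h),
      fderiv_eq_zero_of_notMem_tsupport (hM ξ h)⟩)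
    hu.tendsto hu.tendsto_fderiv (fun _ _ => tendsto_const_nhds)
    (fun _ _ => tendsto_const_nhds)).2
  have lim2 := (tendsto_integral_of_poleWeight_bound hyz
    (F := fun n ξ => u n ξ * (lap φ ξ + ((kappa0 κ1 κ2 ξ : ℝ) : ℂ) ^ 2 * φ ξ))
    (f := fun ξ => w ξ * (lap φ ξ + ((kappa0 κ1 κ2 ξ : ℝ) : ℂ) ^ 2 * φ ξ))
    (M := M) (C := A * (B' + (κ1 ^ 2 + κ2 ^ 2) * B))
    (fun n => (hu.contDiff n).continuous.aestronglyMeasurable.mul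
      ((continuous_lap hφ2).aestronglyMeasurable.add
        (hk.aestronglyMeasurable.mul hφ1.continuous.aestronglyMeasurable)))
    (by
      intro n ξ hξ hy _
      have h1 : ‖lap φ ξ + ((kappa0 κ1 κ2 ξ : ℝ) : ℂ) ^ 2 * φ ξ‖
          ≤ B' + (κ1 ^ 2 + κ2 ^ 2) * B := by
        refine (norm_add_le _ _).trans ?_
        rw [norm_mul]
        gcongr
        · exact hB' ξ
        · exact norm_kappa0_sq_le κ1 κ2 ξ
        · exact (hφb ξ).1
      have h2 := (hub n ξ hξ hy).1
      have h0 : 0 ≤ A * poleWeight y ξ := mul_nonneg hA (poleWeight_nonneg _ _)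
      rw [norm_mul]
      calc _ ≤ (A * poleWeight y ξ) * (B' + (κ1 ^ 2 + κ2 ^ 2) * B) := by gcongr
        _ ≤ (A * poleWeight y ξ) * (B' + (κ1 ^ 2 + κ2 ^ 2) * B) * poleWeight z ξ :=
            le_mul_of_one_le_right (by positivity) (one_le_poleWeight z ξ)
        _ = _ := by ring)
    (fun n ξ h => by
      simp [lap_eq_zero_of_notMem_tsupport (hM ξ h), image_eq_zero_of_notMem_tsupport (hM ξ h)])
    (fun ξ hy _ => (hu.tendsto ξ hy).mul_const _)).2
  have heq (n : ℕ) : ∫ ξ, u n ξ * (lap φ ξ + ((kappa0 κ1 κ2 ξ : ℝ) : ℂ) ^ 2 * φ ξ)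
      = ∫ ξ, weakIntegrand κ1 κ2 (u n) φ ξ := by
    have hun := hu.contDiff n
    have i1 : Integrable (fun ξ => u n ξ * lap φ ξ) volume :=
      (hun.continuous.mul (continuous_lap hφ2)).integrable_of_hasCompactSupport hlapc.mul_left
    have i2 : Integrable (fun ξ => ((kappa0 κ1 κ2 ξ : ℝ) : ℂ) ^ 2 * (u n ξ * φ ξ)) volume :=
      ((hun.continuous.mul hφ1.continuous).integrable_of_hasCompactSupport hc.mul_left).bdd_mul
        hk.aestronglyMeasurable (.of_forall (norm_kappa0_sq_le κ1 κ2))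
    have i3 : Integrable (gradDot (u n) φ) volume := by
      have h (v : Pt) : Integrable (fun ξ => fderiv ℝ (u n) ξ v * fderiv ℝ φ ξ v) volume :=
        (((hun.continuous_fderiv one_ne_zero).clm_apply continuous_const).mul
          ((hφ1.continuous_fderiv one_ne_zero).clm_apply
            continuous_const)).integrable_of_hasCompactSupport (hc.fderiv_apply ℝ v).mul_left
      exact (h _).add (h _)
    have e1 : (fun ξ => u n ξ * (lap φ ξ + ((kappa0 κ1 κ2 ξ : ℝ) : ℂ) ^ 2 * φ ξ))
        = fun ξ => u n ξ * lap φ ξ + ((kappa0 κ1 κ2 ξ : ℝ) : ℂ) ^ 2 * (u n ξ * φ ξ) := by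
      ext ξ; ring
    simp only [weakIntegrand]
    rw [e1, integral_add i1 i2, integral_sub i2 i3, integral_mul_lap hun hφ2 hc]
    ring
  rw [← hw φ hφ hc]
  simp only [heq] at lim2
  exact tendsto_nhds_unique lim1 lim2

lemma fderiv_normed_convolution (ρ : ContDiffBump (0 : Pt)) {φ : Pt → ℂ} (hφ : ContDiff ℝ 1 φ)
    (hc : HasCompactSupport φ) (ξ : Pt) :
    fderiv ℝ (convolution (ρ.normed volume) φ (ContinuousLinearMap.lsmul ℝ ℝ) volume) ξ
      = convolution (ρ.normed volume) (fderiv ℝ φ) (ContinuousLinearMap.lsmul ℝ ℝ) volume ξ := by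
  rw [(hc.hasFDerivAt_convolution_right (ContinuousLinearMap.lsmul ℝ ℝ)
    (ρ.continuous_normed.locallyIntegrable) hφ ξ).fderiv]
  simp only [convolution]
  congr 1

/-- The first-order weak formulation, for `C¹` test functions. -/
lemma IsPointSourceSol.integral_weakIntegrand {κ1 κ2 : ℝ} {w : Pt → ℂ} {y : Pt}
    (hw : IsPointSourceSol κ1 κ2 w y) {u : ℕ → Pt → ℂ} (hu : PoleApprox w y u)
    {φ : Pt → ℂ} (hφ : ContDiff ℝ 1 φ) (hc : HasCompactSupport φ) :
    ∫ ξ, weakIntegrand κ1 κ2 w φ ξ = -φ y := by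
  obtain ⟨z, hyz⟩ := exists_ne_pt y
  obtain ⟨M, hM⟩ := hc.exists_radius
  obtain ⟨A, hA, hwb⟩ := hu.bound_limit (M + 1)
  obtain ⟨B, hB, hφb⟩ := exists_bound_of_contDiff hφ hc
  set ρ : ℕ → ContDiffBump (0 : Pt) := fun n =>
    ⟨1 / ((n : ℝ) + 1) / 2, 1 / ((n : ℝ) + 1), by positivity, half_lt_self (by positivity)⟩
    with hρ
  have hρ0 : Tendsto (fun n => (ρ n).rOut) atTop (𝓝 0) :=
    tendsto_one_div_add_atTop_nhds_zero_nat
  have hρ1 (n : ℕ) : (ρ n).rOut ≤ 1 := by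
    change 1 / ((n : ℝ) + 1) ≤ 1
    rw [div_le_one (by positivity)]
    linarith [(Nat.cast_nonneg n : (0 : ℝ) ≤ n)]
  have hφ' : Continuous (fderiv ℝ φ) := hφ.continuous_fderiv one_ne_zero
  set ψ : ℕ → Pt → ℂ := fun n =>
    convolution ((ρ n).normed volume) φ (ContinuousLinearMap.lsmul ℝ ℝ) volume with hψ
  have hψd (n : ℕ) (ξ : Pt) : fderiv ℝ (ψ n) ξ = convolution ((ρ n).normed volume) (fderiv ℝ φ)
      (ContinuousLinearMap.lsmul ℝ ℝ) volume ξ := fderiv_normed_convolution (ρ n) hφ hc ξ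
  have hψs (n : ℕ) : ContDiff ℝ (⊤ : ℕ∞) (ψ n) :=
    (ρ n).hasCompactSupport_normed.contDiff_convolution_left _ (ρ n).contDiff_normed
      hφ.continuous.locallyIntegrable
  have hψ1 (n : ℕ) : ContDiff ℝ 1 (ψ n) := contDiff_infty.1 (hψs n) 1
  have hψc (n : ℕ) : HasCompactSupport (ψ n) :=
    (ρ n).hasCompactSupport_normed.convolution _ hc
  have hlim (ξ : Pt) : Tendsto (fun n => ψ n ξ) atTop (𝓝 (φ ξ)) :=
    ContDiffBump.convolution_tendsto_right_of_continuous hρ0 hφ.continuous ξ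
  have hlim' (ξ : Pt) : Tendsto (fun n => fderiv ℝ (ψ n) ξ) atTop (𝓝 (fderiv ℝ φ ξ)) := by
    simp only [hψd]
    exact ContDiffBump.convolution_tendsto_right_of_continuous hρ0 hφ' ξ
  have hbd (n : ℕ) (ξ : Pt) : ‖ψ n ξ‖ ≤ 3 * B ∧ ‖fderiv ℝ (ψ n) ξ‖ ≤ 3 * B := by
    constructor
    · have h := ContDiffBump.dist_normed_convolution_le (φ := ρ n) (g := φ) (μ := volume)
        (x₀ := ξ) (ε := 2 * B) hφ.continuous.aestronglyMeasurable (fun ζ _ => by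
          rw [dist_eq_norm]
          exact (norm_sub_le _ _).trans (by linarith [(hφb ζ).1, (hφb ξ).1]))
      rw [dist_eq_norm] at h
      have h2 := norm_le_norm_add_norm_sub' (ψ n ξ) (φ ξ)
      linarith [(hφb ξ).1]
    · have h := ContDiffBump.dist_normed_convolution_le (φ := ρ n) (g := fderiv ℝ φ) (μ := volume)
        (x₀ := ξ) (ε := 2 * B) hφ'.aestronglyMeasurable (fun ζ _ => by
          rw [dist_eq_norm]
          exact (norm_sub_le _ _).trans (by linarith [(hφb ζ).2, (hφb ξ).2]))
      rw [← hψd, dist_eq_norm] at h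
      have h2 := norm_le_norm_add_norm_sub' (fderiv ℝ (ψ n) ξ) (fderiv ℝ φ ξ)
      linarith [(hφb ξ).2]
  have hzero (n : ℕ) (ξ : Pt) (hξ : M + 1 < ‖ξ‖) : ψ n ξ = 0 ∧ fderiv ℝ (ψ n) ξ = 0 := by
    have hball (ζ : Pt) (hζ : ζ ∈ Metric.ball ξ (ρ n).rOut) : ζ ∉ tsupport φ := by
      refine hM ζ ?_
      rw [Metric.mem_ball, dist_comm, dist_eq_norm] at hζ
      have h1 := norm_le_norm_add_norm_sub' ξ ζ
      linarith [hρ1 n]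
    have hξ' : ξ ∉ tsupport φ := hM ξ (by linarith)
    constructor
    · have h := ContDiffBump.dist_normed_convolution_le (φ := ρ n) (g := φ) (μ := volume)
        (x₀ := ξ) (ε := 0) hφ.continuous.aestronglyMeasurable (fun ζ hζ => by
          rw [image_eq_zero_of_notMem_tsupport (hball ζ hζ),
            image_eq_zero_of_notMem_tsupport hξ', dist_self])
      rw [image_eq_zero_of_notMem_tsupport hξ'] at h
      exact dist_le_zero.1 h
    · have h := ContDiffBump.dist_normed_convolution_le (φ := ρ n) (g := fderiv ℝ φ) (μ := volume)
        (x₀ := ξ) (ε := 0) hφ'.aestronglyMeasurable (fun ζ hζ => by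
          rw [fderiv_eq_zero_of_notMem_tsupport (hball ζ hζ),
            fderiv_eq_zero_of_notMem_tsupport hξ', dist_self])
      rw [← hψd, fderiv_eq_zero_of_notMem_tsupport hξ'] at h
      exact dist_le_zero.1 h
  have hz1 (ξ : Pt) : 3 * B ≤ 3 * B * poleWeight z ξ :=
    le_mul_of_one_le_right (by positivity) (one_le_poleWeight z ξ)
  have lim := (tendsto_integral_weakIntegrand κ1 κ2 hyz (u := fun _ => w) (v := ψ) (a := w)
    (b := φ) (M := M + 1) (A := A) (B := 3 * B) (fun _ => hu.aestronglyMeasurable)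
    (fun _ => hu.aestronglyMeasurable_fderiv)
    (fun n => (hψ1 n).continuous.aestronglyMeasurable)
    (fun n => ((hψ1 n).continuous_fderiv one_ne_zero).aestronglyMeasurable)
    (fun _ => hwb) (fun n ξ _ _ => ⟨(hbd n ξ).1.trans (hz1 ξ), (hbd n ξ).2.trans (hz1 ξ)⟩)
    hzero (fun _ _ => tendsto_const_nhds) (fun _ _ => tendsto_const_nhds)
    (fun ξ _ => hlim ξ) (fun ξ _ => hlim' ξ)).2
  exact tendsto_nhds_unique
    (lim.congr fun n => hw.integral_weakIntegrand_smooth hu (hψs n) (hψc n)) (hlim y).neg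

lemma fderiv_mul_apply_of_differentiableAt {f g : Pt → ℂ} {ξ : Pt} (hf : DifferentiableAt ℝ f ξ)
    (hg : DifferentiableAt ℝ g ξ) (v : Pt) :
    fderiv ℝ (fun ζ => f ζ * g ζ) ξ v = f ξ * fderiv ℝ g ξ v + fderiv ℝ f ξ v * g ξ := by
  rw [fderiv_fun_mul hf hg]
  simp [mul_comm]

/-- The weak formulation tested against a cutoff times another point-source solution. -/
lemma IsPointSourceSol.integral_weakIntegrand_mul {κ1 κ2 : ℝ} {a b : Pt → ℂ} {x z : Pt}
    (hxz : x ≠ z) (ha : IsPointSourceSol κ1 κ2 a x) {u v : ℕ → Pt → ℂ} (hu : PoleApprox a x u)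
    (hv : PoleApprox b z v) (hbd : ∀ ξ, ξ ≠ z → DifferentiableAt ℝ b ξ)
    {χ : Pt → ℂ} (hχ : ContDiff ℝ 1 χ) (hc : HasCompactSupport χ) :
    Integrable (weakIntegrand κ1 κ2 a fun ξ => χ ξ * b ξ) volume ∧
      ∫ ξ, weakIntegrand κ1 κ2 a (fun ζ => χ ζ * b ζ) ξ = -(χ x * b x) := by
  obtain ⟨M, hM⟩ := hc.exists_radius
  obtain ⟨A, hA, hab⟩ := hu.bound_limit M
  obtain ⟨B, hB, hvb⟩ := hv.bound M
  obtain ⟨K, hK, hχb⟩ := exists_bound_of_contDiff hχ hc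
  have hφ (n : ℕ) : ContDiff ℝ 1 fun ξ => χ ξ * v n ξ := hχ.mul (hv.contDiff n)
  have hφc (n : ℕ) : HasCompactSupport fun ξ => χ ξ * v n ξ := hc.mul_right
  have hdχ (ξ : Pt) : DifferentiableAt ℝ χ ξ := hχ.differentiable one_ne_zero ξ
  have hdv (n : ℕ) (ξ : Pt) : DifferentiableAt ℝ (v n) ξ :=
    (hv.contDiff n).differentiable one_ne_zero ξ
  obtain ⟨hi, lim⟩ := tendsto_integral_weakIntegrand κ1 κ2 hxz (u := fun _ => a)
    (v := fun n ξ => χ ξ * v n ξ) (a := a) (b := fun ξ => χ ξ * b ξ) (M := M) (A := A)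
    (B := 2 * (K * B)) (fun _ => hu.aestronglyMeasurable)
    (fun _ => hu.aestronglyMeasurable_fderiv) (fun n => (hφ n).continuous.aestronglyMeasurable)
    (fun n => ((hφ n).continuous_fderiv one_ne_zero).aestronglyMeasurable) (fun _ => hab)
    (by
      intro n ξ hξ hz
      obtain ⟨h1, h2⟩ := hvb n ξ hξ hz
      obtain ⟨h3, h4⟩ := hχb ξ
      have h0 : 0 ≤ K * (B * poleWeight z ξ) :=
        mul_nonneg hK (mul_nonneg hB (poleWeight_nonneg _ _))
      have e1 : ‖χ ξ‖ * ‖v n ξ‖ ≤ K * (B * poleWeight z ξ) := by gcongr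
      have e2 : ‖χ ξ‖ * ‖fderiv ℝ (v n) ξ‖ ≤ K * (B * poleWeight z ξ) := by gcongr
      have e3 : ‖v n ξ‖ * ‖fderiv ℝ χ ξ‖ ≤ K * (B * poleWeight z ξ) := by
        rw [mul_comm]; gcongr
      constructor
      · rw [norm_mul]; linarith
      · rw [fderiv_fun_mul (hdχ ξ) (hdv n ξ)]
        refine (norm_add_le _ _).trans ?_
        rw [norm_smul, norm_smul]
        linarith)
    (fun n ξ h => by
      have h1 := hM ξ h
      refine ⟨by simp [image_eq_zero_of_notMem_tsupport h1], ?_⟩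
      ext e
      rw [fderiv_mul_apply_of_differentiableAt (hdχ ξ) (hdv n ξ),
        image_eq_zero_of_notMem_tsupport h1, fderiv_eq_zero_of_notMem_tsupport h1]
      simp)
    (fun _ _ => tendsto_const_nhds) (fun _ _ => tendsto_const_nhds)
    (fun ξ h => (hv.tendsto ξ h).const_mul _)
    (fun ξ h => by
      rw [fderiv_fun_mul (hdχ ξ) (hbd ξ h)]
      refine Tendsto.congr (fun n => (fderiv_fun_mul (hdχ ξ) (hdv n ξ)).symm) ?_
      exact ((hv.tendsto_fderiv ξ h).const_smul _).add ((hv.tendsto ξ h).smul_const _))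
  refine ⟨hi, ?_⟩
  exact tendsto_nhds_unique
    (lim.congr fun n => ha.integral_weakIntegrand hu (hφ n) (hφc n))
    ((hv.tendsto x hxz).const_mul _).neg

lemma hasFDerivAt_norm_pt {ξ : Pt} (hξ : ξ ≠ 0) :
    HasFDerivAt (fun ζ : Pt => ‖ζ‖) (‖ξ‖⁻¹ • innerSL ℝ ξ) ξ := by
  have hn : 0 < ‖ξ‖ := norm_pos_iff.2 hξ
  have h := ((hasFDerivAt_id ξ).norm_sq).sqrt (by simpa using hn.ne')
  simp only [id, Real.sqrt_sq (norm_nonneg _)] at h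
  refine h.congr_fderiv ?_
  ext v
  simp
  field_simp

/-- A radial cutoff whose radial profile has a prescribed derivative `-p`. -/
lemma exists_radial_cutoff {p : ℝ → ℝ} (hp : Continuous p) (hc : HasCompactSupport p) {m : ℝ}
    (hm : 0 ≤ m) (hs : tsupport p ⊆ Set.Ioi m) :
    ∃ χ : Pt → ℂ, ContDiff ℝ 1 χ ∧ HasCompactSupport χ ∧
      (∀ ξ, ‖ξ‖ ≤ m → χ ξ = ((∫ r, p r : ℝ) : ℂ)) ∧
      ∀ ξ v, fderiv ℝ χ ξ v = ((-(p ‖ξ‖ * ‖ξ‖⁻¹ * inner ℝ ξ v) : ℝ) : ℂ) := by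
  set g : ℝ → ℝ := fun r => (∫ t, p t) - ∫ t in (0 : ℝ)..r, p t with hg
  have hgd (r : ℝ) : HasDerivAt g (-p r) r :=
    ((hp.integral_hasStrictDerivAt 0 r).hasDerivAt).const_sub _
  have hg1 : ContDiff ℝ 1 g := by
    rw [contDiff_one_iff_deriv]
    refine ⟨fun r => (hgd r).differentiableAt, ?_⟩
    rw [show deriv g = fun r => -p r from funext fun r => (hgd r).deriv]
    exact hp.neg
  have hgm (r : ℝ) (h0 : 0 ≤ r) (hr : r ≤ m) : g r = ∫ t, p t := by
    have h : ∫ t in (0 : ℝ)..r, p t = 0 := by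
      rw [intervalIntegral.integral_congr (g := fun _ => (0 : ℝ))]
      · simp
      · intro t ht
        rw [Set.uIcc_of_le h0] at ht
        exact image_eq_zero_of_notMem_tsupport fun h => absurd (hs h) (not_lt.2 (ht.2.trans hr))
    simp [hg, h]
  obtain ⟨N, hN⟩ := hc.isBounded.subset_closedBall 0
  have hgN (r : ℝ) (hr : N ≤ r) : g r = 0 := by
    have h : Function.support p ⊆ Set.Ioc 0 r := fun t ht => by
      have h1 := subset_tsupport p ht
      have h2 := mem_closedBall_zero_iff.1 (hN h1)
      exact ⟨hm.trans_lt (hs h1), (le_abs_self t).trans (h2.trans hr)⟩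
    simp [hg, intervalIntegral.integral_eq_integral_of_support_subset h]
  have hnear : ∀ᶠ ξ : Pt in 𝓝 0, ((g ‖ξ‖ : ℝ) : ℂ) = ((∫ t, p t : ℝ) : ℂ) := by
    have h0 : (tsupport p)ᶜ ∈ 𝓝 (0 : ℝ) :=
      (isClosed_tsupport p).isOpen_compl.mem_nhds fun h => absurd (hs h) (not_lt.2 hm)
    obtain ⟨δ, hδ, hball⟩ := Metric.mem_nhds_iff.1 h0
    filter_upwards [Metric.ball_mem_nhds (0 : Pt) hδ] with ξ hξ
    have h : ∫ t in (0 : ℝ)..‖ξ‖, p t = 0 := by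
      rw [intervalIntegral.integral_congr (g := fun _ => (0 : ℝ))]
      · simp
      · intro t ht
        rw [Set.uIcc_of_le (norm_nonneg _)] at ht
        refine image_eq_zero_of_notMem_tsupport (hball ?_)
        rw [mem_ball_zero_iff] at hξ ⊢
        rw [Real.norm_of_nonneg ht.1]
        exact ht.2.trans_lt hξ
    simp [hg, h]
  refine ⟨fun ξ => ((g ‖ξ‖ : ℝ) : ℂ), ?_, ?_, ?_, ?_⟩
  · rw [contDiff_iff_contDiffAt]
    intro ξ
    by_cases hξ : ξ = 0
    · subst hξ
      exact contDiffAt_const.congr_of_eventuallyEq hnear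
    · exact Complex.ofRealCLM.contDiff.contDiffAt.comp ξ
        (hg1.contDiffAt.comp ξ (contDiffAt_norm ℝ hξ))
  · refine HasCompactSupport.intro (isCompact_closedBall (0 : Pt) N) fun ξ hξ => ?_
    rw [mem_closedBall_zero_iff, not_le] at hξ
    simp [hgN _ hξ.le]
  · intro ξ hξ
    simp only [hgm _ (norm_nonneg ξ) hξ]
  · intro ξ v
    by_cases hξ : ξ = 0
    · subst hξ
      rw [Filter.EventuallyEq.fderiv_eq (f := fun _ : Pt => ((∫ t, p t : ℝ) : ℂ)) hnear]
      simp
    · have h := Complex.ofRealCLM.hasFDerivAt.comp ξ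
        ((hgd ‖ξ‖).comp_hasFDerivAt ξ (hasFDerivAt_norm_pt hξ))
      rw [show (fun ξ : Pt => ((g ‖ξ‖ : ℝ) : ℂ)) = Complex.ofRealCLM ∘ (g ∘ fun ζ : Pt => ‖ζ‖) from
        rfl, h.fderiv]
      simp
      ring

lemma integral_pt_eq_polar (F : Pt → ℂ) :
    ∫ ξ, F ξ = ∫ q in Set.Ioi (0 : ℝ) ×ˢ Set.Ioo (-π) π, q.1 • F (ptc q.1 q.2) := by
  have h := ((volume_preserving_finTwoArrow ℝ).comp
    (EuclideanSpace.volume_preserving_symm_measurableEquiv_toLp (Fin 2))).integral_comp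
    ((MeasurableEquiv.toLp 2 (Fin 2 → ℝ)).symm.trans
      MeasurableEquiv.finTwoArrow).measurableEmbedding (fun q : ℝ × ℝ => F (pt q.1 q.2))
  rw [← integral_comp_polarCoord_symm] at h
  refine Eq.trans ?_ h
  refine integral_congr_ae (.of_forall fun ξ => ?_)
  refine congrArg F ?_
  ext i; fin_cases i <;> rfl

lemma ptc_add_two_pi (r θ : ℝ) : ptc r (θ + 2 * π) = ptc r θ := by
  simp [ptc]

lemma circInt_eq_integral_Ioo (r : ℝ) (F : Pt → ℂ) :
    circInt r F = ∫ θ in Set.Ioo (-π) π, F (ptc r θ) * (r : ℂ) := by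
  have hper : Function.Periodic (fun θ => F (ptc r θ) * (r : ℂ)) (2 * π) := fun θ => by
    simp only [ptc_add_two_pi]
  have h := hper.intervalIntegral_add_eq 0 (-π)
  rw [zero_add, show -π + 2 * π = π by ring] at h
  rw [circInt, h, intervalIntegral.integral_of_le (by linarith [Real.pi_pos]),
    integral_Ioc_eq_integral_Ioo]

lemma continuousOn_circInt {G : Pt → ℂ} {m : ℝ}
    (hG : ContinuousOn G {ξ | m < ‖ξ‖}) : ContinuousOn (fun r => circInt r G) (Set.Ioi m) := by
  intro r₀ hr₀
  obtain ⟨r₁, h1, h2⟩ := exists_between (Set.mem_Ioi.1 hr₀)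
  have hc : Continuous fun r => circInt (max r r₁) G := by
    refine intervalIntegral.continuous_parametric_intervalIntegral_of_continuous'
      (f := fun r θ => G (ptc (max r r₁) θ) * ((max r r₁ : ℝ) : ℂ)) ?_ 0 (2 * π)
    refine Continuous.mul ?_ (by fun_prop)
    refine hG.comp_continuous (f := fun q : ℝ × ℝ => ptc (max q.1 r₁) q.2)
      (continuous_ptc.comp (by fun_prop : Continuous fun q : ℝ × ℝ => (max q.1 r₁, q.2))) ?_
    intro q
    rw [Set.mem_ofPred_eq, norm_ptc]
    exact h1.trans_le ((le_max_right _ _).trans (le_abs_self _))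
  refine (hc.continuousAt.congr ?_).continuousWithinAt
  filter_upwards [lt_mem_nhds h2] with r hr
  rw [max_eq_left hr.le]

/-- Integration in polar coordinates against a radial weight supported away from the disc. -/
lemma integral_radial_mul {G : Pt → ℂ} {m : ℝ} (hm : 0 ≤ m) (hG : ContinuousOn G {ξ | m < ‖ξ‖})
    {p : ℝ → ℝ} (hp : Continuous p) (hc : HasCompactSupport p) (hs : tsupport p ⊆ Set.Ioi m) :
    ∫ ξ, (p ‖ξ‖ : ℂ) * G ξ = ∫ r, p r • circInt r G := by
  set H : ℝ × ℝ → ℂ := fun q => (p q.1 : ℂ) * (G (ptc q.1 q.2) * (q.1 : ℂ)) with hH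
  have hts : tsupport H ⊆ {q | m < q.1} := by
    have h : tsupport H ⊆ Prod.fst ⁻¹' tsupport p := by
      refine closure_minimal (fun q hq => subset_tsupport p fun h0 => hq ?_)
        ((isClosed_tsupport p).preimage continuous_fst)
      simp [hH, h0]
    exact fun q hq => hs (h hq)
  have hHc : Continuous H := by
    refine ContinuousOn.continuous_of_tsupport_subset (s := {q | m < q.1}) ?_
      (isOpen_lt continuous_const continuous_fst) hts
    refine ContinuousOn.mul (by fun_prop) (ContinuousOn.mul ?_ (by fun_prop))
    refine hG.comp (t := {ξ | m < ‖ξ‖}) continuous_ptc.continuousOn fun q hq => ?_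
    rw [Set.mem_ofPred_eq, norm_ptc]
    exact lt_of_lt_of_le hq (le_abs_self _)
  obtain ⟨N, hN⟩ := hc.isBounded.subset_closedBall 0
  have hHi : IntegrableOn H (Set.Ioi (0 : ℝ) ×ˢ Set.Ioo (-π) π) (volume.prod volume) := by
    have h := hHc.continuousOn.integrableOn_compact (μ := volume)
      ((isCompact_Icc (a := (0 : ℝ)) (b := N)).prod (isCompact_Icc (a := -π) (b := π)))
    refine h.of_forall_sdiff_eq_zero (measurableSet_Ioi.prod measurableSet_Ioo) fun q hq => ?_
    obtain ⟨⟨h1, h2⟩, h3⟩ := hq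
    have h4 : q.1 ∉ tsupport p := fun h4 => h3
      ⟨⟨le_of_lt h1, (le_abs_self _).trans (mem_closedBall_zero_iff.1 (hN h4))⟩, h2.1.le, h2.2.le⟩
    simp [hH, image_eq_zero_of_notMem_tsupport h4]
  have hzero (r : ℝ) (hr : r ∉ Set.Ioi (0 : ℝ)) : p r • circInt r G = 0 := by
    have h4 : r ∉ tsupport p := fun h4 => hr (hm.trans_lt (hs h4))
    simp [image_eq_zero_of_notMem_tsupport h4]
  rw [integral_pt_eq_polar, ← setIntegral_eq_integral_of_forall_compl_eq_zero hzero]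
  have e : ∫ q in Set.Ioi (0 : ℝ) ×ˢ Set.Ioo (-π) π,
      q.1 • ((p ‖ptc q.1 q.2‖ : ℂ) * G (ptc q.1 q.2))
      = ∫ q in Set.Ioi (0 : ℝ) ×ˢ Set.Ioo (-π) π, H q ∂(volume.prod volume) := by
    refine setIntegral_congr_fun (measurableSet_Ioi.prod measurableSet_Ioo) fun q hq => ?_
    have h1 : (0 : ℝ) < q.1 := hq.1
    simp only [hH, norm_ptc, abs_of_pos h1, Complex.real_smul]
    ring
  rw [e, setIntegral_prod H hHi]
  refine setIntegral_congr_fun measurableSet_Ioi fun r _ => ?_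
  simp only [hH]
  rw [integral_const_mul, circInt_eq_integral_Ioo, Complex.real_smul]

lemma dnu_eq (F : Pt → ℂ) (ξ : Pt) : dnu F ξ = (‖ξ‖⁻¹ : ℝ) *
    ((ξ 0 : ℝ) * fderiv ℝ F ξ (pt 1 0) + (ξ 1 : ℝ) * fderiv ℝ F ξ (pt 0 1)) := by
  have h : fderiv ℝ F ξ ξ
      = (ξ 0 : ℝ) * fderiv ℝ F ξ (pt 1 0) + (ξ 1 : ℝ) * fderiv ℝ F ξ (pt 0 1) := by
    refine (congrArg (fderiv ℝ F ξ) (eq_smul_pt_add_smul_pt ξ)).trans ?_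
    rw [map_add, map_smul, map_smul, Complex.real_smul, Complex.real_smul]
  rw [dnu, map_smul, h, Complex.real_smul]

lemma weakIntegrand_mul_sub {κ1 κ2 : ℝ} {w1 w2 χ : Pt → ℂ} {ξ : Pt} {p : ℝ → ℝ}
    (h1 : DifferentiableAt ℝ w1 ξ) (h2 : DifferentiableAt ℝ w2 ξ) (h3 : DifferentiableAt ℝ χ ξ)
    (hχ : ∀ v, fderiv ℝ χ ξ v = ((-(p ‖ξ‖ * ‖ξ‖⁻¹ * inner ℝ ξ v) : ℝ) : ℂ)) :
    weakIntegrand κ1 κ2 w1 (fun ζ => χ ζ * w2 ζ) ξ - weakIntegrand κ1 κ2 w2 (fun ζ => χ ζ * w1 ζ) ξ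
      = -((p ‖ξ‖ : ℂ) * (w1 ξ * dnu w2 ξ - dnu w1 ξ * w2 ξ)) := by
  have i0 : inner ℝ ξ (pt 1 0) = ξ 0 := by simp [pt, PiLp.inner_apply, Fin.sum_univ_two]
  have i1 : inner ℝ ξ (pt 0 1) = ξ 1 := by simp [pt, PiLp.inner_apply, Fin.sum_univ_two]
  simp only [weakIntegrand, gradDot, fderiv_mul_apply_of_differentiableAt h3 h2,
    fderiv_mul_apply_of_differentiableAt h3 h1, hχ, i0, i1, dnu_eq]
  push_cast
  ring

lemma continuousOn_dnu {w : Pt → ℂ} {y : Pt} {m : ℝ} (hm : 0 ≤ m) (hy : ‖y‖ ≤ m)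
    (hw : ContDiffOn ℝ 1 w {y}ᶜ) :
    ContinuousOn w {ξ | m < ‖ξ‖} ∧ ContinuousOn (dnu w) {ξ | m < ‖ξ‖} := by
  have hsub : {ξ : Pt | m < ‖ξ‖} ⊆ {y}ᶜ := by
    rintro ξ hξ rfl
    exact absurd hξ (not_lt.2 hy)
  refine ⟨hw.continuousOn.mono hsub, ?_⟩
  refine ((hw.continuousOn_fderiv_of_isOpen isOpen_compl_singleton le_rfl).mono hsub).clm_apply ?_
  refine ContinuousOn.smul (continuous_norm.continuousOn.inv₀ fun ξ hξ => ?_) continuousOn_id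
  exact (hm.trans_lt hξ).ne'

/-- Green's identity over ∂B_R for two point-source solutions w₁ (source x) and
w₂ (source z) of the two-layer Helmholtz equation:
∫_{∂B_R} (w₁ ∂_νw₂ − (∂_νw₁) w₂) ds = w₂(x) − w₁(z). -/
theorem green_identity_two_sources
    (κ1 κ2 : ℝ) (hκ1 : 0 < κ1) (hκ2 : 0 < κ2)
    (R : ℝ) (hR : 0 < R) (x z : Pt) (hxR : ‖x‖ < R) (hzR : ‖z‖ < R)
    (hx2 : x 1 ≠ 0) (hz2 : z 1 ≠ 0) (hxz : x ≠ z)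
    (w1 w2 : Pt → ℂ)
    (hw1loc : LocallyIntegrable w1 volume) (hw2loc : LocallyIntegrable w2 volume)
    (hw1sol : IsPointSourceSol κ1 κ2 w1 x) (hw2sol : IsPointSourceSol κ1 κ2 w2 z)
    (hw1sing : HasLogSingularity w1 x) (hw2sing : HasLogSingularity w2 z)
    (hw1reg : SourceRegular w1 x) (hw2reg : SourceRegular w2 z) :
    circInt R (fun ξ => w1 ξ * dnu w2 ξ - dnu w1 ξ * w2 ξ) = w2 x - w1 z := by
  obtain ⟨u1, hu1⟩ := exists_poleApprox hw1sing hw1reg.1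
  obtain ⟨u2, hu2⟩ := exists_poleApprox hw2sing hw2reg.1
  have hd1 : ∀ ξ, ξ ≠ x → DifferentiableAt ℝ w1 ξ := fun ξ h =>
    (hw1reg.1.contDiffAt (isOpen_compl_singleton.mem_nhds h)).differentiableAt one_ne_zero
  have hd2 : ∀ ξ, ξ ≠ z → DifferentiableAt ℝ w2 ξ := fun ξ h =>
    (hw2reg.1.contDiffAt (isOpen_compl_singleton.mem_nhds h)).differentiableAt one_ne_zero
  set m : ℝ := max ‖x‖ ‖z‖ with hmdef
  have hm : 0 ≤ m := (norm_nonneg x).trans (le_max_left _ _)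
  have hxm : ‖x‖ ≤ m := le_max_left _ _
  have hzm : ‖z‖ ≤ m := le_max_right _ _
  set G : Pt → ℂ := fun ξ => w1 ξ * dnu w2 ξ - dnu w1 ξ * w2 ξ with hGdef
  have hG : ContinuousOn G {ξ | m < ‖ξ‖} := by
    obtain ⟨c1, c2⟩ := continuousOn_dnu hm hxm hw1reg.1
    obtain ⟨c3, c4⟩ := continuousOn_dnu hm hzm hw2reg.1
    exact (c1.mul c4).sub (c2.mul c3)
  have hC := continuousOn_circInt hG
  have hCA : ContinuousOn (fun r => circInt r G - (w2 x - w1 z)) (Set.Ioi m) :=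
    hC.sub continuousOn_const
  have key : ∀ p : ℝ → ℝ, ContDiff ℝ (⊤ : ℕ∞) p → HasCompactSupport p → tsupport p ⊆ Set.Ioi m →
      ∫ r, p r • (circInt r G - (w2 x - w1 z)) = 0 := by
    intro p hps hc hs
    have hp := hps.continuous
    obtain ⟨χ, hχ, hχc, hχm, hχd⟩ := exists_radial_cutoff hp hc hm hs
    obtain ⟨i1, e1⟩ := hw1sol.integral_weakIntegrand_mul hxz hu1 hu2 hd2 hχ hχc
    obtain ⟨i2, e2⟩ := hw2sol.integral_weakIntegrand_mul hxz.symm hu2 hu1 hd1 hχ hχc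
    have e3 : ∫ ξ, (p ‖ξ‖ : ℂ) * G ξ = ((∫ r, p r : ℝ) : ℂ) * (w2 x - w1 z) := by
      have h : ∫ ξ, (weakIntegrand κ1 κ2 w1 (fun ζ => χ ζ * w2 ζ) ξ
          - weakIntegrand κ1 κ2 w2 (fun ζ => χ ζ * w1 ζ) ξ) = ∫ ξ, -((p ‖ξ‖ : ℂ) * G ξ) := by
        refine integral_congr_ae ?_
        filter_upwards [Measure.ae_ne volume x, Measure.ae_ne volume z] with ξ hx hz
        exact weakIntegrand_mul_sub (hd1 ξ hx) (hd2 ξ hz) (hχ.differentiable one_ne_zero ξ) (hχd ξ)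
      rw [integral_sub i1 i2, e1, e2, integral_neg, hχm x hxm, hχm z hzm] at h
      linear_combination h
    rw [integral_radial_mul hm hG hp hc hs] at e3
    have hpi : Integrable p volume := hp.integrable_of_hasCompactSupport hc
    have hpC : Integrable (fun r => p r • circInt r G) volume := by
      refine Continuous.integrable_of_hasCompactSupport ?_ hc.smul_right
      exact (hp.continuousOn.smul hC).continuous_of_tsupport_subset isOpen_Ioi
        ((tsupport_smul_subset_left p _).trans hs)
    simp only [smul_sub]
    rw [integral_sub hpC (hpi.smul_const _ |>.congr (.of_forall fun r => smul_sub _ _ _)), e3]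
    simp only [← smul_sub]
    rw [integral_smul_const, Complex.real_smul, sub_self]
  have hae := isOpen_Ioi.ae_eq_zero_of_integral_contDiff_smul_eq_zero (μ := volume)
    (hCA.locallyIntegrableOn measurableSet_Ioi) key
  have hEq := Measure.eqOn_open_of_ae_eq (μ := volume) (g := fun _ => (0 : ℂ))
    ((ae_restrict_iff' measurableSet_Ioi).2 hae) isOpen_Ioi hCA continuousOn_const
  exact sub_eq_zero.1 (hEq (show R ∈ Set.Ioi m from max_lt hxR hzR))

end
end
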